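/- The additive group homomorphism A → ℂ[x] × ℂ given by M ↦ (tr M, (M₀₀)(0)) has kernel exactly [A,A] and image exactly E × ℂ, where E ⊆ ℂ[x] is the subring of even polynomials; hence it induces an isomorphism of additive groups A/[A,A] ≅ E × ℂ. Moreover this isomorphism is equivariant for the action of the center of A: for every even polynomial f, the class of (f·1)·M is sent to (f·tr M, f(0)·(M₀₀)(0)). In particular, as a module over the center ℂ[t] of A (with t = x²·1), the cocenter A/[A,A] is isomorphic to ℂ[t] ⊕ ℂ[t]/(t), where ℂ[t] acts on the second summand through evaluation at t = 0. -/

import Mathlib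

open Polynomial

/-- The subalgebra `A ⊆ Mat₂(ℂ[x])` of matrices `(a_{ij})` with
`a_{ij}(-x) = (-1)^{i-j} a_{ij}(x)`: diagonal entries even, off-diagonal entries odd. -/
noncomputable def cellRing : Subalgebra ℂ (Matrix (Fin 2) (Fin 2) (Polynomial ℂ)) where
  carrier := {M | ∀ i j, aeval (-X : Polynomial ℂ) (M i j)
      = (if i = j then 1 else -1) * M i j}
  mul_mem' := by
    intro M N hM hN
    simp only [Set.mem_setOf_eq] at hM hN ⊢
    intro i k
    have hs : ∀ i j k : Fin 2,
        (if i = j then (1 : Polynomial ℂ) else -1) * (if j = k then 1 else -1)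
          = (if i = k then 1 else -1) := by
      intro i j k
      fin_cases i <;> fin_cases j <;> fin_cases k <;> norm_num
    simp only [Matrix.mul_apply, map_sum, map_mul, Finset.mul_sum]
    refine Finset.sum_congr rfl fun j _ => ?_
    rw [hM i j, hN j k, ← hs i j k]
    ring
  one_mem' := by
    simp only [Set.mem_setOf_eq]
    intro i j
    by_cases h : i = j
    · subst h; simp
    · simp [Matrix.one_apply_ne h, h]
  add_mem' := by
    intro M N hM hN
    simp only [Set.mem_setOf_eq] at hM hN ⊢
    intro i j
    simp only [Matrix.add_apply, map_add, hM i j, hN i j, mul_add]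
  zero_mem' := by
    simp only [Set.mem_setOf_eq]
    intro i j
    simp
  algebraMap_mem' := by
    intro c
    simp only [Set.mem_setOf_eq]
    intro i j
    by_cases h : i = j
    · subst h; simp [Matrix.algebraMap_matrix_apply]
    · simp [Matrix.algebraMap_matrix_apply, h]

/-- The additive subgroup of a ring generated by all commutators `a * b - b * a`;
the quotient by it is the cocenter (zeroth Hochschild homology). -/
def commutatorAddSubgroup (B : Type*) [Ring B] : AddSubgroup B :=
  AddSubgroup.closure {x | ∃ a b : B, x = a * b - b * a}

/-- The additive map `A → ℂ[x] × ℂ`, `M ↦ (tr M, (M₀₀)(0))`. -/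
noncomputable def phi : cellRing →+ Polynomial ℂ × ℂ where
  toFun M := (Matrix.trace (M : Matrix (Fin 2) (Fin 2) (Polynomial ℂ)),
      Polynomial.eval 0 ((M : Matrix (Fin 2) (Fin 2) (Polynomial ℂ)) 0 0))
  map_zero' := by simp
  map_add' := by
    intro M N
    simp [Prod.ext_iff, Matrix.add_apply]

theorem expand_contract_two_of_even {f : Polynomial ℂ} (hf : aeval (-X : Polynomial ℂ) f = f) :
    expand ℂ 2 (contract 2 f) = f := by
  ext n
  rw [coeff_expand two_pos]
  split_ifs with h
  · rw [coeff_contract two_ne_zero, Nat.div_mul_cancel h]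
  · have hX : (-X : Polynomial ℂ) = C (-1) * X := by simp
    have hn := congrArg (fun p => coeff p n) hf
    rw [hX, ← comp_eq_aeval] at hn
    simp only [comp_C_mul_X_coeff] at hn
    rw [(Nat.not_even_iff_odd.mp (fun e => h e.two_dvd)).neg_one_pow] at hn
    linear_combination (1 / 2 : ℂ) * hn

theorem aeval_neg_X_expand_two (f : Polynomial ℂ) :
    aeval (-X : Polynomial ℂ) (expand ℂ 2 f) = expand ℂ 2 f := by
  rw [expand_aeval, neg_sq, expand_eq_comp_X_pow, comp_eq_aeval]

theorem eval_zero_eq_zero_of_odd {f : Polynomial ℂ} (hf : aeval (-X : Polynomial ℂ) f = -f) :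
    eval 0 f = 0 := by
  have h := congrArg (eval 0) hf
  rw [← comp_eq_aeval, eval_comp, eval_neg, eval_X, neg_zero, eval_neg] at h
  linear_combination (1 / 2 : ℂ) * h

theorem exists_odd_of_even_of_eval_zero {a : Polynomial ℂ}
    (ha : aeval (-X : Polynomial ℂ) a = a) (h0 : eval 0 a = 0) :
    ∃ d : Polynomial ℂ, aeval (-X : Polynomial ℂ) d = -d ∧ a = X * d := by
  obtain ⟨d, rfl⟩ : X ∣ a := X_dvd_iff.mpr (by rwa [coeff_zero_eq_eval_zero])
  refine ⟨d, mul_left_cancel₀ (X_ne_zero (R := ℂ)) ?_, rfl⟩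
  rw [map_mul, aeval_X] at ha
  linear_combination -ha

/-- The element of `cellRing` with the given even diagonal and odd off-diagonal entries. -/
noncomputable def cellRingOfEntries (a b c d : Polynomial ℂ)
    (ha : aeval (-X : Polynomial ℂ) a = a) (hb : aeval (-X : Polynomial ℂ) b = -b)
    (hc : aeval (-X : Polynomial ℂ) c = -c) (hd : aeval (-X : Polynomial ℂ) d = d) : cellRing :=
  ⟨!![a, b; c, d], by
    intro i j
    fin_cases i <;> fin_cases j <;> simp [ha, hb, hc, hd]⟩

theorem cellRing_even_diag (M : cellRing) (i : Fin 2) :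
    aeval (-X : Polynomial ℂ) (M.1 i i) = M.1 i i := by
  simpa using M.2 i i

theorem cellRing_odd_off_diag (M : cellRing) {i j : Fin 2} (h : i ≠ j) :
    aeval (-X : Polynomial ℂ) (M.1 i j) = -M.1 i j := by
  simpa [h] using M.2 i j

theorem cellRing_eval_zero_off_diag (M : cellRing) {i j : Fin 2} (h : i ≠ j) :
    eval 0 (M.1 i j) = 0 :=
  eval_zero_eq_zero_of_odd (cellRing_odd_off_diag M h)

theorem cellRing_even_trace (M : cellRing) :
    aeval (-X : Polynomial ℂ) (Matrix.trace M.1) = Matrix.trace M.1 := by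
  rw [Matrix.trace_fin_two, map_add, cellRing_even_diag M, cellRing_even_diag M]

theorem phi_fst (M : cellRing) : (phi M).1 = Matrix.trace M.1 := rfl

theorem phi_snd (M : cellRing) : (phi M).2 = eval 0 (M.1 0 0) := rfl

theorem phi_commutator (a b : cellRing) : phi (a * b - b * a) = 0 := by
  refine Prod.ext ?_ ?_
  · rw [phi_fst]
    simp [Matrix.trace_sub, Matrix.trace_mul_comm a.1 b.1]
  · rw [phi_snd]
    have h01 : (0 : Fin 2) ≠ 1 := zero_ne_one
    simp [Matrix.mul_apply, Fin.sum_univ_two, cellRing_eval_zero_off_diag a h01,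
      cellRing_eval_zero_off_diag b h01, mul_comm]

theorem mul_sub_mul_mem_commutatorAddSubgroup {B : Type*} [Ring B] (a b : B) :
    a * b - b * a ∈ commutatorAddSubgroup B :=
  AddSubgroup.subset_closure ⟨a, b, rfl⟩

theorem ker_phi : phi.ker = commutatorAddSubgroup cellRing := by
  refine le_antisymm (fun M hM => ?_) ?_
  · have htr : M.1 0 0 + M.1 1 1 = 0 := by
      rw [← Matrix.trace_fin_two]
      exact congrArg Prod.fst hM
    obtain ⟨o, ho, hao⟩ := exists_odd_of_even_of_eval_zero (cellRing_even_diag M 0)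
      (congrArg Prod.snd hM)
    have hX : aeval (-X : Polynomial ℂ) (X : Polynomial ℂ) = -X := aeval_X _
    have h0 : aeval (-X : Polynomial ℂ) (0 : Polynomial ℂ) = 0 := map_zero _
    have h0' : aeval (-X : Polynomial ℂ) (0 : Polynomial ℂ) = -0 := by simp
    have h1 : aeval (-X : Polynomial ℂ) (1 : Polynomial ℂ) = 1 := map_one _
    have h01 : (0 : Fin 2) ≠ 1 := zero_ne_one
    let E0 := cellRingOfEntries 1 0 0 0 h1 h0' h0' h0
    let E1 := cellRingOfEntries 0 0 0 1 h0 h0' h0' h1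
    let U := cellRingOfEntries 0 (M.1 0 1) 0 0 h0 (cellRing_odd_off_diag M h01) h0' h0
    let L := cellRingOfEntries 0 0 (M.1 1 0) 0 h0 h0' (cellRing_odd_off_diag M h01.symm) h0
    let P := cellRingOfEntries 0 X 0 0 h0 hX h0' h0
    let Q := cellRingOfEntries 0 0 o 0 h0 h0' ho h0
    have key : M = (P * Q - Q * P) + (E0 * U - U * E0) + (E1 * L - L * E1) := by
      apply Subtype.ext
      ext1 i j
      fin_cases i <;> fin_cases j <;>
        simp [P, Q, E0, E1, U, L, cellRingOfEntries, hao]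
      linear_combination htr - hao
    rw [key]
    exact add_mem (add_mem (mul_sub_mul_mem_commutatorAddSubgroup _ _)
      (mul_sub_mul_mem_commutatorAddSubgroup _ _)) (mul_sub_mul_mem_commutatorAddSubgroup _ _)
  · refine (AddSubgroup.closure_le _).mpr ?_
    rintro _ ⟨a, b, rfl⟩
    exact phi_commutator a b

theorem exists_phi_eq {p : Polynomial ℂ} (hp : aeval (-X : Polynomial ℂ) p = p) (c : ℂ) :
    ∃ M : cellRing, phi M = (p, c) := by
  refine ⟨cellRingOfEntries (C c) 0 0 (p - C c) (by simp) (by simp) (by simp) (by simp [hp]), ?_⟩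
  refine Prod.ext ?_ ?_
  · simp [phi_fst, cellRingOfEntries, Matrix.trace_fin_two]
  · simp [phi_snd, cellRingOfEntries]

theorem range_phi :
    Set.range phi = {q : Polynomial ℂ × ℂ | aeval (-X : Polynomial ℂ) q.1 = q.1} := by
  ext ⟨p, c⟩
  refine ⟨?_, fun hp => exists_phi_eq hp c⟩
  rintro ⟨M, hM⟩
  have h := cellRing_even_trace M
  rw [← phi_fst, hM] at h
  exact h

theorem phi_smul_one_mul {f : Polynomial ℂ} {Z : cellRing}
    (hZ : (Z : Matrix (Fin 2) (Fin 2) (Polynomial ℂ))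
      = f • (1 : Matrix (Fin 2) (Fin 2) (Polynomial ℂ))) (M : cellRing) :
    phi (Z * M) = (f * (phi M).1, eval 0 f * (phi M).2) := by
  have h : (Z * M).1 = f • M.1 := by
    rw [MulMemClass.coe_mul, hZ, smul_mul_assoc, one_mul]
  refine Prod.ext ?_ ?_
  · rw [phi_fst, h, Matrix.trace_smul, smul_eq_mul, phi_fst]
  · rw [phi_snd, h, Matrix.smul_apply, smul_eq_mul, eval_mul, phi_snd]

/-- The map `phi` read in `ℂ[t] × ℂ[t]/(t)`, where `t = x²`. -/
noncomputable def phiQuot :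
    cellRing →+ Polynomial ℂ × (Polynomial ℂ ⧸ Ideal.span {(X : Polynomial ℂ)}) where
  toFun M := (contract 2 (phi M).1, Ideal.Quotient.mk _ (C (phi M).2))
  map_zero' := by
    refine Prod.ext ?_ ?_
    · simpa using contract_C (p := 2) (0 : ℂ)
    · simp
  map_add' M N := by
    refine Prod.ext ?_ ?_
    · simp [contract_add two_ne_zero]
    · simp

theorem phiQuot_apply (M : cellRing) :
    phiQuot M = (contract 2 (phi M).1, Ideal.Quotient.mk _ (C (phi M).2)) := rfl

theorem mk_span_X_C_eval_zero (r : Polynomial ℂ) :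
    Ideal.Quotient.mk (Ideal.span {(X : Polynomial ℂ)}) (C (eval 0 r))
      = Ideal.Quotient.mk _ r := by
  rw [Ideal.Quotient.eq, Ideal.mem_span_singleton, X_dvd_iff, coeff_zero_eq_eval_zero]
  simp

theorem ker_phiQuot : phiQuot.ker = commutatorAddSubgroup cellRing := by
  rw [← ker_phi]
  ext M
  rw [AddMonoidHom.mem_ker, AddMonoidHom.mem_ker, phiQuot_apply]
  constructor
  · intro h
    obtain ⟨h1, h2⟩ := Prod.ext_iff.mp h
    refine Prod.ext ?_ ?_
    · have h3 := expand_contract_two_of_even (cellRing_even_trace M)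
      rw [← phi_fst, show contract 2 (phi M).1 = 0 from h1, map_zero] at h3
      exact h3.symm
    · have h3 := Ideal.Quotient.eq_zero_iff_mem.mp h2
      rw [Ideal.mem_span_singleton, X_dvd_iff, coeff_C_zero] at h3
      exact h3
  · intro h
    rw [← phiQuot_apply]
    have h0 := phiQuot_apply 0
    rw [map_zero phi, ← h, map_zero, ← phiQuot_apply] at h0
    exact h0.symm

theorem phiQuot_surjective : Function.Surjective phiQuot := by
  rintro ⟨p, r⟩
  obtain ⟨r, rfl⟩ := Ideal.Quotient.mk_surjective r
  obtain ⟨M, hM⟩ := exists_phi_eq (aeval_neg_X_expand_two p) (eval 0 r)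
  refine ⟨M, ?_⟩
  rw [phiQuot_apply, hM]
  exact Prod.ext (contract_expand 2 two_ne_zero) (mk_span_X_C_eval_zero r)

theorem phiQuot_smul_one_mul {f : Polynomial ℂ} {Z : cellRing}
    (hZ : (Z : Matrix (Fin 2) (Fin 2) (Polynomial ℂ))
      = (f.comp (X ^ 2)) • (1 : Matrix (Fin 2) (Fin 2) (Polynomial ℂ))) (M : cellRing) :
    phiQuot (Z * M) = (f * (phiQuot M).1, Ideal.Quotient.mk _ f * (phiQuot M).2) := by
  rw [phiQuot_apply, phi_smul_one_mul hZ, phiQuot_apply]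
  refine Prod.ext ?_ ?_
  · change contract 2 (f.comp (X ^ 2) * (phi M).1) = f * contract 2 (phi M).1
    rw [← expand_eq_comp_X_pow, mul_comm, contract_mul_expand two_ne_zero, mul_comm]
  · simp [← mk_span_X_C_eval_zero f]

/-- The map `M ↦ (tr M, (M₀₀)(0))` has kernel `[A,A]` and image `E × ℂ` (`E` the even
polynomials), is equivariant for the action of the center (`f` even central scalar acts
by `(p, c) ↦ (f·p, f(0)·c)`), and induces an isomorphism of the cocenter `A/[A,A]`,
as a module over the center `ℂ[t]` (`t = x² • 1`), with `ℂ[t] ⊕ ℂ[t]/(t)`. -/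
theorem stmt4 :
    phi.ker = commutatorAddSubgroup cellRing ∧
    Set.range phi = {q : Polynomial ℂ × ℂ | aeval (-X : Polynomial ℂ) q.1 = q.1} ∧
    (∀ (f : Polynomial ℂ) (Z M : cellRing),
      aeval (-X : Polynomial ℂ) f = f →
      (Z : Matrix (Fin 2) (Fin 2) (Polynomial ℂ))
          = f • (1 : Matrix (Fin 2) (Fin 2) (Polynomial ℂ)) →
      phi (Z * M) = (f * (phi M).1, Polynomial.eval 0 f * (phi M).2)) ∧
    ∃ e : (cellRing ⧸ commutatorAddSubgroup cellRing) ≃+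
        (Polynomial ℂ) × (Polynomial ℂ ⧸ Ideal.span {(X : Polynomial ℂ)}),
      ∀ (f : Polynomial ℂ) (Z M : cellRing),
        (Z : Matrix (Fin 2) (Fin 2) (Polynomial ℂ))
            = (f.comp (X ^ 2)) • (1 : Matrix (Fin 2) (Fin 2) (Polynomial ℂ)) →
        e (QuotientAddGroup.mk' (commutatorAddSubgroup cellRing) (Z * M))
          = (f * (e (QuotientAddGroup.mk' (commutatorAddSubgroup cellRing) M)).1,
             (Ideal.Quotient.mk (Ideal.span {(X : Polynomial ℂ)}) f)
               * (e (QuotientAddGroup.mk' (commutatorAddSubgroup cellRing) M)).2) := by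
  refine ⟨ker_phi, range_phi, fun f Z M _ hZ => phi_smul_one_mul hZ M,
    (QuotientAddGroup.quotientAddEquivOfEq ker_phiQuot.symm).trans
      (QuotientAddGroup.quotientKerEquivOfSurjective phiQuot phiQuot_surjective),
    fun f Z M hZ => phiQuot_smul_one_mul hZ M⟩
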